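/- arXiv:1503.00424 — 2 statements merged into one kernel-verified Lean document; each statement's English description precedes it below -/
import Mathlib

section
/- Let A ∈ ℝ^{m×n} with m ≥ n, let B = A + E with ‖E‖ ≤ σ_min(A)/2 in spectral norm, and assume rank(A) = rank(B) = n. Then the Moore–Penrose pseudoinverses satisfy ‖B^† − A^†‖ ≤ 2√2 ‖E‖ / σ_min(A)². -/
open Matrix Finset

/-- Euclidean norm on `ι → ℝ`. -/
noncomputable def enorm' {ι : Type*} [Fintype ι] (x : ι → ℝ) : ℝ :=
  Real.sqrt (∑ i, x i ^ 2)

/-- The `j`-th largest singular value of a matrix, via the Courant–Fischer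
max–min characterization. -/
noncomputable def singVal {m' n' : Type*} [Fintype m'] [Fintype n']
    (A : Matrix m' n' ℝ) (j : ℕ) : ℝ :=
  sSup {r : ℝ | ∃ V : Submodule ℝ (n' → ℝ), Module.finrank ℝ V = j ∧
    ∀ x ∈ V, enorm' x = 1 → r ≤ enorm' (A.mulVec x)}

/-- Moore–Penrose pseudoinverse of a full-column-rank matrix, `A† = (AᵀA)⁻¹Aᵀ`. -/
noncomputable def pinv {m' n' : Type*} [Fintype m'] [Fintype n'] [DecidableEq n']
    (A : Matrix m' n' ℝ) : Matrix n' m' ℝ :=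
  (Aᵀ * A)⁻¹ * Aᵀ

theorem enorm'_eq_norm {ι : Type*} [Fintype ι] (x : ι → ℝ) :
    enorm' x = ‖WithLp.toLp 2 x‖ := by
  simp [enorm', EuclideanSpace.norm_eq]

section Projections

variable {W : Type*} [NormedAddCommGroup W] [InnerProductSpace ℝ W] [FiniteDimensional ℝ W]

theorem norm_sq_eq_starProjection_add_sub (L : Submodule ℝ W) (x : W) :
    ‖x‖ ^ 2 = ‖L.starProjection x‖ ^ 2 + ‖x - L.starProjection x‖ ^ 2 := by
  rw [← Submodule.starProjection_orthogonal_val]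
  exact L.norm_sq_eq_add_norm_sq_starProjection x

/-- For subspaces of equal dimension, a one-sided gap smaller than one bounds the gap in the
opposite direction. -/
theorem norm_sub_starProjection_le_of_finrank_eq {K L : Submodule ℝ W}
    (hfin : Module.finrank ℝ K = Module.finrank ℝ L) {δ : ℝ} (hδ0 : 0 ≤ δ) (hδ1 : δ < 1)
    (h : ∀ x ∈ K, ‖x - L.starProjection x‖ ≤ δ * ‖x‖) {y : W} (hy : y ∈ L) :
    ‖y - K.starProjection y‖ ≤ δ * ‖y‖ := by
  let f : K →ₗ[ℝ] L := (L.orthogonalProjectionOnto : W →ₗ[ℝ] L) ∘ₗ K.subtype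
  have hf : ∀ x : K, (f x : W) = L.starProjection x := fun x => rfl
  have hinj : Function.Injective f := by
    rw [← LinearMap.ker_eq_bot, LinearMap.ker_eq_bot']
    intro x hx
    have h0 : L.starProjection (x : W) = 0 := by rw [← hf, hx]; rfl
    have h1 := h x x.2
    rw [h0, sub_zero] at h1
    have h2 : ‖(x : W)‖ = 0 := by nlinarith [norm_nonneg (x : W)]
    exact Subtype.ext (norm_eq_zero.mp h2)
  obtain ⟨⟨x, hxK⟩, hx⟩ :=
    (LinearMap.injective_iff_surjective_of_finrank_eq_finrank hfin).mp hinj ⟨y, hy⟩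
  have hyx : L.starProjection x = y := by
    rw [← hf ⟨x, hxK⟩, hx]
  have hgap := h x hxK
  have hX := norm_sq_eq_starProjection_add_sub L x
  have hY := norm_sq_eq_starProjection_add_sub K y
  rw [hyx] at hgap hX
  have hinner : ‖y‖ ^ 2 ≤ ‖K.starProjection y‖ * ‖x‖ := by
    have h1 : inner ℝ y x = ‖y‖ ^ 2 := by
      have := L.starProjection_inner_eq_zero x y hy
      rw [hyx, inner_sub_left, real_inner_self_eq_norm_sq, real_inner_comm] at this
      linarith
    have h2 : inner ℝ y x = inner ℝ (K.starProjection y) x := by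
      have := K.starProjection_inner_eq_zero y x hxK
      rw [inner_sub_left] at this
      linarith
    rw [← h1, h2]
    exact real_inner_le_norm _ _
  rcases (norm_nonneg x).eq_or_lt with hx0 | hx0
  · have hy0 : y = 0 := by
      rw [← hyx, norm_eq_zero.mp hx0.symm, map_zero]
    simp [hy0]
  · refine (sq_le_sq₀ (norm_nonneg _) (by positivity)).mp ?_
    have hgap2 : ‖x - y‖ ^ 2 ≤ δ ^ 2 * ‖x‖ ^ 2 := by
      rw [← mul_pow]
      gcongr
    have hsq : (‖y‖ ^ 2) ^ 2 ≤ ‖K.starProjection y‖ ^ 2 * ‖x‖ ^ 2 := by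
      rw [← mul_pow]
      gcongr
    have hcancel : (1 - δ ^ 2) * ‖y‖ ^ 2 ≤ ‖K.starProjection y‖ ^ 2 := by
      refine le_of_mul_le_mul_right ?_ (pow_pos hx0 2)
      nlinarith [sq_nonneg ‖y‖]
    rw [mul_pow]
    linarith

theorem norm_starProjection_le_of_mem_orthogonal {K L : Submodule ℝ W} {δ : ℝ} (hδ0 : 0 ≤ δ)
    (h : ∀ y ∈ L, ‖y - K.starProjection y‖ ≤ δ * ‖y‖) {z : W} (hz : z ∈ Kᗮ) :
    ‖L.starProjection z‖ ≤ δ * ‖z‖ := by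
  set q := L.starProjection z with hq
  have hqL : q ∈ L := L.starProjection_apply_mem z
  have h1 : inner ℝ q z = ‖q‖ ^ 2 := by
    have := L.starProjection_inner_eq_zero z q hqL
    rw [← hq, inner_sub_left, real_inner_self_eq_norm_sq, real_inner_comm] at this
    linarith
  have h2 : inner ℝ (q - K.starProjection q) z = ‖q‖ ^ 2 := by
    rw [inner_sub_left, h1, hz _ (K.starProjection_apply_mem q), sub_zero]
  have h3 : ‖q‖ ^ 2 ≤ δ * ‖q‖ * ‖z‖ := by
    rw [← h2]
    exact (real_inner_le_norm _ _).trans (by gcongr; exact h q hqL)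
  rcases (norm_nonneg q).eq_or_lt with hq0 | hq0
  · rw [← hq0]
    positivity
  · nlinarith

/-- Stability of least-squares solutions: if `u` and `v` solve the normal equations of `a` and `b`
for the same right-hand side `y`, then `v - u` is controlled by the distance of `a` and `b`. -/
theorem norm_leastSquares_sub_le {U : Type*} [NormedAddCommGroup U] [InnerProductSpace ℝ U]
    [FiniteDimensional ℝ U] {a b : U →ₗ[ℝ] W} {σ e : ℝ} (hσ : 0 < σ) (he : 0 ≤ e)
    (heσ : e ≤ σ / 2) (ha : ∀ u, σ * ‖u‖ ≤ ‖a u‖) (hab : ∀ u, ‖b u - a u‖ ≤ e * ‖u‖)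
    {y : W} {u v : U} (hu : ∀ t, inner ℝ (y - a u) (a t) = 0)
    (hv : ∀ t, inner ℝ (y - b v) (b t) = 0) :
    ‖v - u‖ ≤ 2 * Real.sqrt 2 * e / σ ^ 2 * ‖y‖ := by
  have hb : ∀ u, σ / 2 * ‖u‖ ≤ ‖b u‖ := fun u => by
    have h1 := norm_sub_norm_le (a u) (b u)
    rw [norm_sub_rev] at h1
    nlinarith [ha u, hab u, mul_le_mul_of_nonneg_right heσ (norm_nonneg u)]
  have inj_of_bound : ∀ (c : U →ₗ[ℝ] W) (τ : ℝ), 0 < τ → (∀ u, τ * ‖u‖ ≤ ‖c u‖) →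
      Function.Injective c := fun c τ hτ hc => by
    rw [← LinearMap.ker_eq_bot, LinearMap.ker_eq_bot']
    intro x hx
    have h1 := hc x
    rw [hx, norm_zero] at h1
    exact norm_eq_zero.mp (by nlinarith [norm_nonneg x])
  set K := LinearMap.range a with hK
  set L := LinearMap.range b with hL
  have hfin : Module.finrank ℝ K = Module.finrank ℝ L := by
    rw [hK, hL, LinearMap.finrank_range_of_inj (inj_of_bound a σ hσ ha),
      LinearMap.finrank_range_of_inj (inj_of_bound b (σ / 2) (by positivity) hb)]
  have hPK : K.starProjection y = a u :=
    Submodule.eq_starProjection_of_mem_of_inner_eq_zero ⟨u, rfl⟩ (by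
      rintro _ ⟨t, rfl⟩
      exact hu t)
  have hPL : L.starProjection y = b v :=
    Submodule.eq_starProjection_of_mem_of_inner_eq_zero ⟨v, rfl⟩ (by
      rintro _ ⟨t, rfl⟩
      exact hv t)
  have hfix : ∀ t, L.starProjection (b t) = b t := fun t =>
    Submodule.starProjection_eq_self_iff.mpr ⟨t, rfl⟩
  have hδ0 : 0 ≤ e / σ := by positivity
  have hδ1 : e / σ < 1 := by
    rw [div_lt_one hσ]
    linarith
  have hnorm : ∀ t, e * ‖t‖ ≤ e / σ * ‖a t‖ := fun t => by
    rw [div_mul_eq_mul_div, le_div_iff₀ hσ]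
    nlinarith [mul_le_mul_of_nonneg_left (ha t) he]
  have hgap : ∀ x ∈ K, ‖x - L.starProjection x‖ ≤ e / σ * ‖x‖ := by
    rintro _ ⟨t, rfl⟩
    refine le_trans ?_ ((hab t).trans (hnorm t))
    have h1 : a t - L.starProjection (a t) = Lᗮ.starProjection (a t - b t) := by
      rw [Submodule.starProjection_orthogonal_val, map_sub, hfix]
      abel
    rw [h1, norm_sub_rev]
    exact Submodule.norm_starProjection_apply_le _ _
  have hcross : ‖L.starProjection (y - a u)‖ ≤ e / σ * ‖y - a u‖ :=
    norm_starProjection_le_of_mem_orthogonal hδ0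
      (fun z hz => norm_sub_starProjection_le_of_finrank_eq hfin hδ0 hδ1 hgap hz)
      (hPK ▸ K.sub_starProjection_mem_orthogonal y)
  have hdecomp : b (v - u) = L.starProjection (y - a u) - L.starProjection (b u - a u) := by
    simp only [map_sub, hfix, hPL]
    abel
  have hbw : ‖b (v - u)‖ ≤ e / σ * (‖y - a u‖ + ‖a u‖) := by
    rw [hdecomp, mul_add]
    refine (norm_sub_le _ _).trans (add_le_add hcross ?_)
    exact (Submodule.norm_starProjection_apply_le _ _).trans ((hab u).trans (hnorm u))
  have hpyth := norm_sq_eq_starProjection_add_sub K y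
  rw [hPK] at hpyth
  have hsum : ‖y - a u‖ + ‖a u‖ ≤ Real.sqrt 2 * ‖y‖ := by
    refine (sq_le_sq₀ (by positivity) (by positivity)).mp ?_
    rw [mul_pow, Real.sq_sqrt (by norm_num)]
    nlinarith [sq_nonneg (‖y - a u‖ - ‖a u‖)]
  have hfinal : σ / 2 * ‖v - u‖ ≤ e / σ * (Real.sqrt 2 * ‖y‖) :=
    (hb _).trans (hbw.trans (by gcongr))
  calc ‖v - u‖ = 2 / σ * (σ / 2 * ‖v - u‖) := by field_simp
    _ ≤ 2 / σ * (e / σ * (Real.sqrt 2 * ‖y‖)) := by gcongr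
    _ = 2 * Real.sqrt 2 * e / σ ^ 2 * ‖y‖ := by
      field_simp

end Projections

section SingularValues

variable {m' n' : Type*} [Fintype m'] [Fintype n']

theorem singVal_nonneg (M : Matrix m' n' ℝ) (j : ℕ) : 0 ≤ singVal M j := by
  rw [singVal]
  rcases Set.eq_empty_or_nonempty {r : ℝ | ∃ V : Submodule ℝ (n' → ℝ), Module.finrank ℝ V = j ∧
    ∀ x ∈ V, enorm' x = 1 → r ≤ enorm' (M.mulVec x)} with h | ⟨r, V, hV, -⟩
  · rw [h, Real.sSup_empty]
  · exact Real.sSup_nonneg' ⟨0, ⟨V, hV, fun x _ _ => Real.sqrt_nonneg _⟩, le_rfl⟩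

variable [DecidableEq n']

theorem mul_norm_le_norm_toEuclideanLin {M : Matrix m' n' ℝ} {V : Submodule ℝ (n' → ℝ)} {r : ℝ}
    (hr : ∀ x ∈ V, enorm' x = 1 → r ≤ enorm' (M.mulVec x)) {u : EuclideanSpace ℝ n'}
    (hu : u.ofLp ∈ V) : r * ‖u‖ ≤ ‖M.toEuclideanLin u‖ := by
  rcases eq_or_ne u 0 with rfl | hu0
  · simp
  have hpos : 0 < ‖u‖ := norm_pos_iff.mpr hu0
  have h1 := hr (‖u‖⁻¹ • u.ofLp) (V.smul_mem _ hu) (by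
    rw [enorm'_eq_norm, WithLp.toLp_smul, WithLp.toLp_ofLp, norm_smul, norm_inv, norm_norm,
      inv_mul_cancel₀ hpos.ne'])
  rw [enorm'_eq_norm, Matrix.mulVec_smul, WithLp.toLp_smul, norm_smul, norm_inv, norm_norm,
    ← Matrix.toLpLin_apply, ← div_eq_inv_mul, le_div_iff₀ hpos] at h1
  exact h1

theorem le_of_mem_singVal_one_set {M : Matrix m' n' ℝ} {c : ℝ}
    (h : ∀ u, ‖M.toEuclideanLin u‖ ≤ c * ‖u‖) {r : ℝ}
    (hr : ∃ V : Submodule ℝ (n' → ℝ), Module.finrank ℝ V = 1 ∧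
      ∀ x ∈ V, enorm' x = 1 → r ≤ enorm' (M.mulVec x)) : r ≤ c := by
  obtain ⟨V, hV, hr⟩ := hr
  have hbot : V ≠ ⊥ := by
    rintro rfl
    simp at hV
  obtain ⟨x, hxV, hx0⟩ := V.ne_bot_iff.mp hbot
  have hpos : 0 < ‖WithLp.toLp 2 x‖ := by simpa using hx0
  exact le_of_mul_le_mul_right
    ((mul_norm_le_norm_toEuclideanLin hr (u := WithLp.toLp 2 x) hxV).trans (h _)) hpos

theorem singVal_one_le {M : Matrix m' n' ℝ} {c : ℝ} (hc : 0 ≤ c)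
    (h : ∀ u, ‖M.toEuclideanLin u‖ ≤ c * ‖u‖) : singVal M 1 ≤ c :=
  Real.sSup_le (fun _ hr => le_of_mem_singVal_one_set h hr) hc

theorem norm_toEuclideanLin_le_singVal_one (M : Matrix m' n' ℝ) (u : EuclideanSpace ℝ n') :
    ‖M.toEuclideanLin u‖ ≤ singVal M 1 * ‖u‖ := by
  rcases eq_or_ne u 0 with rfl | hu0
  · simp
  have hpos : 0 < ‖u‖ := norm_pos_iff.mpr hu0
  rw [← div_le_iff₀ hpos]
  have hbdd : BddAbove {r : ℝ | ∃ V : Submodule ℝ (n' → ℝ), Module.finrank ℝ V = 1 ∧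
      ∀ x ∈ V, enorm' x = 1 → r ≤ enorm' (M.mulVec x)} :=
    ⟨‖M.toEuclideanLin.toContinuousLinearMap‖, fun _ hr =>
      le_of_mem_singVal_one_set M.toEuclideanLin.toContinuousLinearMap.le_opNorm hr⟩
  refine le_csSup hbdd ⟨ℝ ∙ u.ofLp, finrank_span_singleton (by simpa using hu0), ?_⟩
  intro x hx hx1
  obtain ⟨t, rfl⟩ := Submodule.mem_span_singleton.mp hx
  rw [enorm'_eq_norm, WithLp.toLp_smul, WithLp.toLp_ofLp, norm_smul] at hx1
  rw [enorm'_eq_norm, Matrix.mulVec_smul, WithLp.toLp_smul, ← Matrix.toLpLin_apply, norm_smul,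
    div_le_iff₀ hpos, mul_right_comm, hx1, one_mul]

theorem singVal_card_mul_norm_le (M : Matrix m' n' ℝ) (u : EuclideanSpace ℝ n') :
    singVal M (Fintype.card n') * ‖u‖ ≤ ‖M.toEuclideanLin u‖ := by
  rcases eq_or_ne u 0 with rfl | hu0
  · simp
  have hpos : 0 < ‖u‖ := norm_pos_iff.mpr hu0
  rw [← le_div_iff₀ hpos]
  refine Real.sSup_le ?_ (by positivity)
  rintro r ⟨V, hV, hr⟩
  obtain rfl : V = ⊤ := Submodule.eq_top_of_finrank_eq (by simpa using hV)
  rw [le_div_iff₀ hpos]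
  exact mul_norm_le_norm_toEuclideanLin hr trivial

theorem isUnit_transpose_mul_self_of_rank_eq {M : Matrix m' n' ℝ}
    (hM : M.rank = Fintype.card n') : IsUnit (Mᵀ * M) := by
  rw [← Matrix.mulVec_surjective_iff_isUnit]
  have h : LinearMap.range (Mᵀ * M).mulVecLin = ⊤ := by
    apply Submodule.eq_top_of_finrank_eq
    rw [Module.finrank_fintype_fun_eq_card, ← hM, ← Matrix.rank_transpose_mul_self]
    rfl
  exact LinearMap.range_eq_top.mp h

theorem inner_sub_pinv_eq_zero [DecidableEq m'] {M : Matrix m' n' ℝ}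
    (hM : M.rank = Fintype.card n') (y : EuclideanSpace ℝ m') (t : EuclideanSpace ℝ n') :
    inner ℝ (y - M.toEuclideanLin ((pinv M).toEuclideanLin y)) (M.toEuclideanLin t) = 0 := by
  have hunit := (Matrix.isUnit_iff_isUnit_det _).mp (isUnit_transpose_mul_self_of_rank_eq hM)
  have hnormal : Mᵀ * M * pinv M = Mᵀ := by
    rw [pinv, Matrix.mul_nonsing_inv_cancel_left _ _ hunit]
  have hadj : M.toEuclideanLin = LinearMap.adjoint Mᵀ.toEuclideanLin := by
    rw [← Matrix.toEuclideanLin_conjTranspose_eq_adjoint, Matrix.conjTranspose_eq_transpose_of_trivial,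
      Matrix.transpose_transpose]
  nth_rewrite 2 [hadj]
  rw [LinearMap.adjoint_inner_right]
  have hzero : Mᵀ.toEuclideanLin (y - M.toEuclideanLin ((pinv M).toEuclideanLin y)) = 0 := by
    rw [map_sub, sub_eq_zero]
    simp only [Matrix.toLpLin_apply, Matrix.mulVec_mulVec]
    rw [← Matrix.mul_assoc, hnormal]
  rw [hzero, inner_zero_left]

end SingularValues


/-- Let `A ∈ ℝ^{m×n}` with `m ≥ n`, and `B = A + E` with `‖E‖ ≤ σ_min(A)/2` in spectral
norm (the largest singular value `σ₁`).  If `rank A = rank B = n`, then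
`‖B† − A†‖ ≤ 2√2 ‖E‖ / σ_min(A)²`. -/
theorem pseudoinverse_perturbation_bound
    {m n : ℕ} (hmn : n ≤ m)
    (A E B : Matrix (Fin m) (Fin n) ℝ) (hB : B = A + E)
    (hE : singVal E 1 ≤ singVal A n / 2)
    (hrA : A.rank = n) (hrB : B.rank = n) :
    singVal (pinv B - pinv A) 1 ≤ 2 * Real.sqrt 2 * singVal E 1 / singVal A n ^ 2 := by
  have hσn (u : EuclideanSpace ℝ (Fin n)) : singVal A n * ‖u‖ ≤ ‖A.toEuclideanLin u‖ := by
    simpa using singVal_card_mul_norm_le A u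
  have he := singVal_nonneg E 1
  have hE' := norm_toEuclideanLin_le_singVal_one E
  refine singVal_one_le (by positivity) fun y => ?_
  rcases (singVal_nonneg A n).eq_or_lt with hσ | hσ
  · have he0 : singVal E 1 = 0 := by linarith
    have hE0 : E = 0 := by
      apply Matrix.toEuclideanLin.injective
      rw [map_zero]
      ext1 u
      simpa [he0] using hE' u
    have hBA : B = A := by rw [hB, hE0, add_zero]
    simp [hBA, he0]
  · rw [map_sub, LinearMap.sub_apply]
    refine norm_leastSquares_sub_le (b := B.toEuclideanLin) hσ he hE hσn (fun u => ?_)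
      (inner_sub_pinv_eq_zero (by simpa using hrA) y) (inner_sub_pinv_eq_zero (by simpa using hrB) y)
    rw [hB, map_add, LinearMap.add_apply, add_sub_cancel_left]
    exact hE' u
end

section
/- There exist absolute constants C, C' > 0 such that the following holds. Let a = (a_{i_1,i_2,i_3})_{1 ≤ i_1,i_2,i_3 ≤ n} be a symmetric 3-indexed real array (invariant under all permutations of its indices) with Frobenius norm ‖a‖_F, and let X ∼ N(0, I_n) be a standard Gaussian vector in ℝ^n. Then for any ε > 0, with probability at least 1 − C·n·exp(−C'·n^{2ε/3}), |Σ_{i_1,i_2,i_3=1}^n a_{i_1,i_2,i_3} X_{i_1} X_{i_2} X_{i_3}| ≤ 4 ‖a‖_F · n^{0.5+ε}. -/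
open MeasureTheory ProbabilityTheory Finset

lemma exp_neg_div_sqrt_le {t : ℝ} (ht : |t| ≤ 1 / 4) :
    Real.exp (-t) / √(1 - 2 * t) ≤ Real.exp (4 * t ^ 2) := by
  have ht' := abs_le.1 ht
  have hpos : 0 < 1 - 2 * t := by linarith
  have hlog := Real.abs_log_sub_add_sum_range_le (x := 2 * t)
    (by rw [abs_mul, abs_two]; linarith) 1
  have h2 : |2 * t| ^ (1 + 1) / (1 - |2 * t|) ≤ 8 * t ^ 2 := by
    have : |2 * t| ≤ 1 / 2 := by rw [abs_mul, abs_two]; linarith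
    rw [sq_abs, div_le_iff₀ (by linarith)]
    nlinarith [sq_nonneg t]
  have h3 := abs_le.1 (hlog.trans h2)
  simp only [range_one, sum_singleton, zero_add, pow_one, Nat.cast_zero, div_one] at h3
  rw [← Real.exp_log (Real.sqrt_pos.2 hpos), Real.log_sqrt hpos.le, ← Real.exp_sub,
    Real.exp_le_exp]
  linarith [h3.1]

lemma integral_exp_sq_sub_one_gaussianReal {t : ℝ} (ht : t < 1 / 2) :
    ∫ y, Real.exp (t * (y ^ 2 - 1)) ∂(gaussianReal 0 1) = Real.exp (-t) / √(1 - 2 * t) := by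
  have hpos : 0 < 1 - 2 * t := by linarith
  rw [integral_gaussianReal_eq_integral_smul one_ne_zero]
  have : ∀ y : ℝ, gaussianPDFReal 0 1 y • Real.exp (t * (y ^ 2 - 1)) =
      ((√(2 * Real.pi))⁻¹ * Real.exp (-t)) * Real.exp (-((1 - 2 * t) / 2) * y ^ 2) := by
    intro y
    simp only [gaussianPDFReal, smul_eq_mul, NNReal.coe_one, mul_one, sub_zero]
    rw [mul_assoc, mul_assoc, ← Real.exp_add, ← Real.exp_add]
    ring_nf
  simp_rw [this]
  rw [integral_const_mul, integral_gaussian,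
    show Real.pi / ((1 - 2 * t) / 2) = (2 * Real.pi) / (1 - 2 * t) by field_simp,
    Real.sqrt_div (by positivity)]
  have h2 : 0 < √(2 * Real.pi) := by positivity
  have h3 : 0 < √(1 - 2 * t) := by positivity
  field_simp

lemma integrable_and_integral_exp_sq_sub_one_le {t : ℝ} (ht : |t| ≤ 1 / 4) :
    Integrable (fun y ↦ Real.exp (t * (y ^ 2 - 1))) (gaussianReal 0 1) ∧
    ∫ y, Real.exp (t * (y ^ 2 - 1)) ∂(gaussianReal 0 1) ≤ Real.exp (4 * t ^ 2) := by
  have h := integral_exp_sq_sub_one_gaussianReal (t := t) (by linarith [(abs_le.1 ht).2])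
  refine ⟨?_, h.trans_le (exp_neg_div_sqrt_le ht)⟩
  refine not_imp_comm.1 integral_undef ?_
  rw [h]
  have : 0 < √(1 - 2 * t) := Real.sqrt_pos.2 (by linarith [(abs_le.1 ht).2])
  positivity

/-- Chernoff bound for a sum of functions of the coordinates under a product measure. -/
lemma measureReal_pi_sum_ge_le {ι : Type*} [Fintype ι] {E : ι → Type*}
    [∀ i, MeasurableSpace (E i)] (μ : ∀ i, Measure (E i)) [∀ i, IsProbabilityMeasure (μ i)]
    (f : ∀ i, E i → ℝ) (K : ι → ℝ)
    (hf : ∀ i, Integrable (fun y ↦ Real.exp (f i y)) (μ i))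
    (hK : ∀ i, ∫ y, Real.exp (f i y) ∂(μ i) ≤ Real.exp (K i)) (r : ℝ) :
    (Measure.pi μ).real {x | r ≤ ∑ i, f i (x i)} ≤ Real.exp (∑ i, K i - r) := by
  have hexp : Integrable (fun x : ∀ i, E i ↦ Real.exp (1 * ∑ i, f i (x i))) (Measure.pi μ) := by
    simp_rw [one_mul, Real.exp_sum]
    exact Integrable.fintype_prod_dep hf
  refine (measure_ge_le_exp_mul_mgf r zero_le_one hexp).trans ?_
  rw [sub_eq_neg_add, Real.exp_add, neg_one_mul]
  gcongr
  rw [mgf]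
  simp_rw [one_mul, Real.exp_sum]
  rw [integral_fintype_prod_eq_prod (fun i y ↦ Real.exp (f i y))]
  exact prod_le_prod (fun i _ ↦ integral_nonneg fun _ ↦ (Real.exp_pos _).le) fun i _ ↦ hK i

/-- Sub-Gaussian tail of a linear form in a standard Gaussian vector. -/
lemma gaussian_linear_ge_le {ι : Type*} [Fintype ι] (b : ι → ℝ) {B : ℝ} (hB : 0 < B)
    (hb : ∑ i, b i ^ 2 ≤ B ^ 2) {s : ℝ} (hs : 0 ≤ s) :
    (Measure.pi fun _ : ι ↦ gaussianReal 0 1).real {x | B * s ≤ ∑ i, b i * x i} ≤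
      Real.exp (-s ^ 2 / 2) := by
  rcases hs.eq_or_lt with rfl | hs
  · simp
  have h := measureReal_pi_sum_ge_le (fun _ : ι ↦ gaussianReal 0 1)
    (fun i y ↦ (s / B * b i) * y) (fun i ↦ (s / B * b i) ^ 2 / 2)
    (fun i ↦ integrable_exp_mul_gaussianReal _)
    (fun i ↦ by
      have := congrFun (mgf_fun_id_gaussianReal (μ := 0) (v := 1)) (s / B * b i)
      rw [mgf] at this
      rw [this]
      simp) (s ^ 2)
  have hset : {x : ι → ℝ | B * s ≤ ∑ i, b i * x i} =
      {x | s ^ 2 ≤ ∑ i, (s / B * b i) * x i} := by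
    ext x
    change B * s ≤ _ ↔ s ^ 2 ≤ _
    simp_rw [mul_assoc, ← mul_sum]
    rw [div_mul_eq_mul_div, le_div_iff₀ hB, pow_two, mul_assoc, mul_le_mul_iff_right₀ hs, mul_comm]
  rw [hset]
  refine h.trans (Real.exp_le_exp.2 ?_)
  have : ∑ i, (s / B * b i) ^ 2 / 2 ≤ s ^ 2 / 2 := by
    simp_rw [mul_pow, ← sum_div, ← mul_sum]
    have : (s / B) ^ 2 * ∑ i, b i ^ 2 ≤ (s / B) ^ 2 * B ^ 2 := by gcongr
    rw [← mul_pow, div_mul_cancel₀ _ hB.ne'] at this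
    linarith
  linarith

lemma gaussian_linear_abs_gt_le {ι : Type*} [Fintype ι] (b : ι → ℝ) {B : ℝ} (hB : 0 ≤ B)
    (hb : ∑ i, b i ^ 2 ≤ B ^ 2) {s : ℝ} (hs : 0 ≤ s) :
    (Measure.pi fun _ : ι ↦ gaussianReal 0 1).real {x | B * s < |∑ i, b i * x i|} ≤
      2 * Real.exp (-s ^ 2 / 2) := by
  rcases hB.eq_or_lt with rfl | hB
  · have h0 : ∀ i, b i = 0 := fun i ↦ by
      have := (single_le_sum (fun i _ ↦ sq_nonneg (b i)) (mem_univ i)).trans hb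
      exact pow_eq_zero_iff two_ne_zero |>.1 (le_antisymm (by simpa using this) (sq_nonneg _))
    simp [h0]
    positivity
  have h1 := gaussian_linear_ge_le b hB hb hs
  have h2 := gaussian_linear_ge_le (fun i ↦ -b i) hB (by simpa using hb) hs
  rw [two_mul]
  refine le_trans ?_ ((measureReal_union_le _ _).trans (add_le_add h1 h2))
  refine measureReal_mono (fun x hx ↦ ?_)
  rcases lt_abs.1 (Set.mem_ofPred_eq ▸ hx) with h | h
  · exact Or.inl h.le
  · refine Or.inr ?_
    simpa using h.le

open Matrix in
/-- The standard Gaussian measure is invariant under the orthogonal matrix of eigenvectors. -/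
lemma map_eigenvectorUnitary_mulVec_pi_gaussianReal {ι : Type*} [Fintype ι] [DecidableEq ι]
    {A : Matrix ι ι ℝ} (hA : A.IsHermitian) :
    (Measure.pi fun _ : ι ↦ gaussianReal 0 1).map
      (fun y ↦ (hA.eigenvectorUnitary : Matrix ι ι ℝ) *ᵥ y) =
      Measure.pi fun _ : ι ↦ gaussianReal 0 1 := by
  have h := (map_pi_eq_stdGaussian (ι := ι)).trans
    (stdGaussian_eq_map_pi_orthonormalBasis hA.eigenvectorBasis)
  have h2 := congrArg (Measure.map (WithLp.ofLp (p := 2))) h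
  rw [Measure.map_map (by fun_prop) (by fun_prop), Measure.map_map (by fun_prop) (by fun_prop)]
    at h2
  rw [show (WithLp.ofLp ∘ WithLp.toLp 2 : (ι → ℝ) → ι → ℝ) = id from rfl, Measure.map_id] at h2
  conv_rhs => rw [h2]
  congr 1
  ext y i
  simp [Matrix.mulVec, dotProduct, mul_comm]

open Matrix in
lemma dotProduct_mulVec_eigenvectorUnitary {ι : Type*} [Fintype ι] [DecidableEq ι]
    {A : Matrix ι ι ℝ} (hA : A.IsHermitian) (y : ι → ℝ) :
    ((hA.eigenvectorUnitary : Matrix ι ι ℝ) *ᵥ y) ⬝ᵥ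
      (A *ᵥ ((hA.eigenvectorUnitary : Matrix ι ι ℝ) *ᵥ y)) =
      ∑ i, hA.eigenvalues i * y i ^ 2 := by
  have h := hA.conjStarAlgAut_star_eigenvectorUnitary
  rw [Unitary.conjStarAlgAut_star_apply] at h
  have hadj (w : ι → ℝ) : ((hA.eigenvectorUnitary : Matrix ι ι ℝ) *ᵥ y) ⬝ᵥ w =
      y ⬝ᵥ (star (hA.eigenvectorUnitary : Matrix ι ι ℝ) *ᵥ w) := by
    rw [← vecMul_transpose, ← dotProduct_mulVec, star_eq_conjTranspose,
      conjTranspose_eq_transpose_of_trivial]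
  rw [hadj, mulVec_mulVec, mulVec_mulVec, h]
  simp only [dotProduct, mulVec_diagonal, Function.comp_apply, RCLike.ofReal_real_eq_id, id_eq]
  exact sum_congr rfl fun i _ ↦ by ring

lemma sum_sq_eigenvalues {ι : Type*} [Fintype ι] [DecidableEq ι]
    {A : Matrix ι ι ℝ} (hA : A.IsHermitian) :
    ∑ i, hA.eigenvalues i ^ 2 = ∑ i, ∑ j, A i j ^ 2 := by
  have h1 : (A * A).trace = ∑ i, ∑ j, A i j ^ 2 := by
    simp only [Matrix.trace, Matrix.diag, Matrix.mul_apply]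
    refine sum_congr rfl fun i _ ↦ sum_congr rfl fun j _ ↦ ?_
    have := hA.apply i j
    simp only [star_trivial] at this
    rw [this, sq]
  rw [← h1]
  conv_rhs => rw [hA.spectral_theorem, ← map_mul, Unitary.conjStarAlgAut_apply,
    Matrix.trace_mul_cycle]
  simp [Matrix.trace, sq]

open Matrix in
/-- Sub-exponential upper tail of a centred quadratic form in a standard Gaussian vector
(the Hanson-Wright inequality without the operator norm). -/
lemma gaussian_quadratic_ge_le {ι : Type*} [Fintype ι] [DecidableEq ι]
    {A : Matrix ι ι ℝ} (hA : A.IsHermitian) {F : ℝ} (hF : 0 < F)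
    (hAF : ∑ i, ∑ j, A i j ^ 2 ≤ F ^ 2) (r : ℝ) :
    (Measure.pi fun _ : ι ↦ gaussianReal 0 1).real {x | F * r ≤ x ⬝ᵥ (A *ᵥ x) - A.trace} ≤
      Real.exp ((1 - r) / 4) := by
  have hl : ∑ i, hA.eigenvalues i ^ 2 ≤ F ^ 2 := (sum_sq_eigenvalues hA).trans_le hAF
  have ht (i : ι) : |hA.eigenvalues i / (4 * F)| ≤ 1 / 4 := by
    have h1 := (single_le_sum (fun i _ ↦ sq_nonneg (hA.eigenvalues i)) (mem_univ i)).trans hl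
    have h2 := abs_le_of_sq_le_sq h1 hF.le
    rw [abs_div, abs_of_pos (by positivity : 0 < 4 * F), div_le_iff₀ (by positivity)]
    linarith
  have h := measureReal_pi_sum_ge_le (fun _ : ι ↦ gaussianReal 0 1)
    (fun i y ↦ hA.eigenvalues i / (4 * F) * (y ^ 2 - 1))
    (fun i ↦ 4 * (hA.eigenvalues i / (4 * F)) ^ 2)
    (fun i ↦ (integrable_and_integral_exp_sq_sub_one_le (ht i)).1)
    (fun i ↦ (integrable_and_integral_exp_sq_sub_one_le (ht i)).2) (r / 4)
  have hcont : Continuous fun x : ι → ℝ ↦ x ⬝ᵥ (A *ᵥ x) - A.trace := by fun_prop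
  rw [← map_eigenvectorUnitary_mulVec_pi_gaussianReal hA,
    map_measureReal_apply (Continuous.measurable (by fun_prop))
      (measurableSet_le measurable_const hcont.measurable)]
  have hset : (fun y ↦ (hA.eigenvectorUnitary : Matrix ι ι ℝ) *ᵥ y) ⁻¹'
      {x | F * r ≤ x ⬝ᵥ (A *ᵥ x) - A.trace} =
      {y | r / 4 ≤ ∑ i, hA.eigenvalues i / (4 * F) * (y i ^ 2 - 1)} := by
    ext y
    change F * r ≤ _ ↔ r / 4 ≤ _
    rw [dotProduct_mulVec_eigenvectorUnitary, hA.trace_eq_sum_eigenvalues]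
    simp only [RCLike.ofReal_real_eq_id, id_eq]
    simp_rw [div_mul_eq_mul_div, mul_sub, mul_one]
    rw [← sum_div, sum_sub_distrib, le_div_iff₀ (by positivity),
      show r / 4 * (4 * F) = F * r by ring]
  rw [hset]
  refine h.trans (Real.exp_le_exp.2 ?_)
  have : ∑ i, 4 * (hA.eigenvalues i / (4 * F)) ^ 2 ≤ 1 / 4 := by
    simp_rw [div_pow, ← mul_sum, ← sum_div]
    rw [mul_div_assoc', div_le_iff₀ (by positivity)]
    linarith
  linarith

open Matrix in
lemma gaussian_quadratic_abs_gt_le {ι : Type*} [Fintype ι] [DecidableEq ι]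
    {A : Matrix ι ι ℝ} (hA : A.IsHermitian) {F : ℝ} (hF : 0 ≤ F)
    (hAF : ∑ i, ∑ j, A i j ^ 2 ≤ F ^ 2) (r : ℝ) :
    (Measure.pi fun _ : ι ↦ gaussianReal 0 1).real {x | F * r < |x ⬝ᵥ (A *ᵥ x) - A.trace|} ≤
      2 * Real.exp ((1 - r) / 4) := by
  rcases hF.eq_or_lt with rfl | hF
  · have h0 : A = 0 := by
      ext i j
      have h1 := (single_le_sum (fun j _ ↦ sq_nonneg (A i j)) (mem_univ j)).trans
        ((single_le_sum (f := fun i ↦ ∑ j, A i j ^ 2)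
          (fun i _ ↦ sum_nonneg fun j _ ↦ sq_nonneg (A i j)) (mem_univ i)).trans hAF)
      exact pow_eq_zero_iff two_ne_zero |>.1 (le_antisymm (by simpa using h1) (sq_nonneg _))
    simp [h0]
    positivity
  have h1 := gaussian_quadratic_ge_le hA hF hAF r
  have h2 := gaussian_quadratic_ge_le hA.neg hF (by simpa using hAF) r
  rw [two_mul]
  refine le_trans ?_ ((measureReal_union_le _ _).trans (add_le_add h1 h2))
  refine measureReal_mono (fun x hx ↦ ?_)
  rcases lt_abs.1 (Set.mem_ofPred_eq ▸ hx) with h | h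
  · exact Or.inl h.le
  · refine Or.inr ?_
    change F * r ≤ _
    rw [neg_mulVec, dotProduct_neg, trace_neg]
    linarith

open Matrix in
/-- Deterministic bound for a cubic form `x ↦ ∑ i, x i * (x ⬝ᵥ A i *ᵥ x)`. -/
lemma abs_sum_mul_dotProduct_mulVec_le {ι : Type*} [Fintype ι]
    (A : ι → Matrix ι ι ℝ) (x F : ι → ℝ) {N s T : ℝ} (hN : ∑ i, F i ^ 2 = N ^ 2)
    (hN0 : 0 ≤ N) (hs : 0 ≤ s) (hx : ∀ i, |x i| ≤ s)
    (hq : ∀ i, |x ⬝ᵥ (A i *ᵥ x) - (A i).trace| ≤ F i * s ^ 2)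
    (hl : |∑ i, (A i).trace * x i| ≤ T) :
    |∑ i, x i * (x ⬝ᵥ (A i *ᵥ x))| ≤ √(Fintype.card ι) * N * s ^ 3 + T := by
  have hsplit : ∑ i, x i * (x ⬝ᵥ (A i *ᵥ x)) =
      ∑ i, x i * (x ⬝ᵥ (A i *ᵥ x) - (A i).trace) + ∑ i, (A i).trace * x i := by
    rw [← sum_add_distrib]
    exact sum_congr rfl fun i _ ↦ by ring
  rw [hsplit]
  refine (abs_add_le _ _).trans (add_le_add ?_ hl)
  refine abs_le_of_sq_le_sq ?_ (by positivity)
  refine (sum_mul_sq_le_sq_mul_sq _ _ _).trans ?_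
  have h1 : ∑ i, x i ^ 2 ≤ Fintype.card ι * s ^ 2 := by
    rw [← nsmul_eq_mul, ← card_univ]
    exact sum_le_card_nsmul _ _ _ fun i _ ↦ sq_le_sq' (abs_le.1 (hx i)).1 (abs_le.1 (hx i)).2
  have h2 : ∑ i, (x ⬝ᵥ (A i *ᵥ x) - (A i).trace) ^ 2 ≤ N ^ 2 * s ^ 4 := by
    rw [← hN, sum_mul]
    refine sum_le_sum fun i _ ↦ ?_
    have := sq_le_sq' (abs_le.1 (hq i)).1 (abs_le.1 (hq i)).2
    linarith [this, mul_pow (F i) (s ^ 2) 2, pow_mul s 2 2]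
  calc _ ≤ (Fintype.card ι * s ^ 2) * (N ^ 2 * s ^ 4) :=
        mul_le_mul h1 h2 (sum_nonneg fun _ _ ↦ sq_nonneg _) (by positivity)
    _ = (√(Fintype.card ι) * N * s ^ 3) ^ 2 := by
        rw [mul_pow, mul_pow, Real.sq_sqrt (by positivity)]
        ring

open Matrix in
lemma sum_trace_sq_le {ι : Type*} [Fintype ι] (A : ι → Matrix ι ι ℝ) :
    ∑ i, (A i).trace ^ 2 ≤ Fintype.card ι * ∑ i, ∑ j, ∑ l, A i j l ^ 2 := by
  rw [mul_sum]
  refine sum_le_sum fun i _ ↦ ?_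
  refine (sq_sum_le_card_mul_sum_sq (s := univ) (f := fun j ↦ A i j j)).trans ?_
  rw [card_univ]
  gcongr with j
  exact single_le_sum (f := fun l ↦ A i j l ^ 2) (fun l _ ↦ sq_nonneg _) (mem_univ j)

open Matrix in
/-- Concentration of a cubic form with symmetric slices, at scale `s ≥ 1`. -/
lemma gaussian_cubic_abs_gt_le {ι : Type*} [Fintype ι] [DecidableEq ι] [Nonempty ι]
    (A : ι → Matrix ι ι ℝ) (hA : ∀ i, (A i).IsHermitian) {s : ℝ} (hs : 1 ≤ s) :
    (Measure.pi fun _ : ι ↦ gaussianReal 0 1).real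
      {x | 4 * √(∑ i, ∑ j, ∑ l, A i j l ^ 2) * (√(Fintype.card ι) * s ^ 3) <
        |∑ i, x i * (x ⬝ᵥ (A i *ᵥ x))|} ≤
      10 * Fintype.card ι * Real.exp (-(1 / 4) * s ^ 2) := by
  set μ := Measure.pi fun _ : ι ↦ gaussianReal 0 1
  set N := √(∑ i, ∑ j, ∑ l, A i j l ^ 2)
  set F : ι → ℝ := fun i ↦ √(∑ j, ∑ l, A i j l ^ 2)
  have hs0 : 0 ≤ s := by linarith
  have hF2 (i : ι) : F i ^ 2 = ∑ j, ∑ l, A i j l ^ 2 := Real.sq_sqrt (by positivity)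
  have hN2 : N ^ 2 = ∑ i, ∑ j, ∑ l, A i j l ^ 2 := Real.sq_sqrt (by positivity)
  have hN0 : 0 ≤ N := Real.sqrt_nonneg _
  set b : ℝ := √(Fintype.card ι) * N with hb
  have hb0 : 0 ≤ b := by positivity
  have hb2 : ∑ i, (A i).trace ^ 2 ≤ b ^ 2 := by
    rw [hb, mul_pow, Real.sq_sqrt (by positivity), hN2]
    exact sum_trace_sq_le A
  have hsub : {x | 4 * N * (√(Fintype.card ι) * s ^ 3) < |∑ i, x i * (x ⬝ᵥ (A i *ᵥ x))|} ⊆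
      ((⋃ i, {x | 1 * s < |∑ j, (Pi.single i 1 : ι → ℝ) j * x j|}) ∪
        ⋃ i, {x | F i * s ^ 2 < |x ⬝ᵥ (A i *ᵥ x) - (A i).trace|}) ∪
        {x | b * s < |∑ i, (A i).trace * x i|} := by
    intro x hx
    by_contra hcon
    simp only [Set.mem_union, Set.mem_iUnion, Set.mem_ofPred_eq, not_or, not_exists, not_lt] at hcon
    obtain ⟨⟨h1, h2⟩, h3⟩ := hcon
    have h4 := abs_sum_mul_dotProduct_mulVec_le A x F (N := N) (s := s) (T := b * s)
      (by rw [hN2]; exact sum_congr rfl fun i _ ↦ hF2 i) hN0 hs0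
      (fun i ↦ by simpa [Pi.single_apply] using h1 i) h2 h3
    have h5 : s ≤ s ^ 3 := le_self_pow₀ hs (by norm_num)
    have h6 : b * s ≤ b * s ^ 3 := by gcongr
    have h7 : 0 ≤ b * s ^ 3 := by positivity
    have hx' : 4 * N * (√(Fintype.card ι) * s ^ 3) < _ := hx
    rw [show 4 * N * (√(Fintype.card ι) * s ^ 3) = 4 * (b * s ^ 3) by rw [hb]; ring] at hx'
    rw [← hb] at h4
    linarith
  set E := Real.exp (-(1 / 4) * s ^ 2)
  have hE0 : 0 < E := Real.exp_pos _
  have hE1 : Real.exp (-s ^ 2 / 2) ≤ E := Real.exp_le_exp.2 (by linarith [sq_nonneg s])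
  have hE2 : Real.exp ((1 - s ^ 2) / 4) ≤ 3 * E := by
    rw [show (1 - s ^ 2) / 4 = 1 / 4 + -(1 / 4) * s ^ 2 by ring, Real.exp_add]
    gcongr
    calc Real.exp (1 / 4) ≤ Real.exp 1 := Real.exp_le_exp.2 (by norm_num)
      _ ≤ 3 := Real.exp_one_lt_three.le
  have hcard : (1 : ℝ) ≤ Fintype.card ι := by exact_mod_cast Fintype.card_pos
  have hm1 : μ.real (⋃ i, {x | 1 * s < |∑ j, (Pi.single i 1 : ι → ℝ) j * x j|}) ≤
      Fintype.card ι * (2 * E) := by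
    refine (measureReal_iUnion_fintype_le _).trans ?_
    rw [← nsmul_eq_mul, ← card_univ]
    refine sum_le_card_nsmul _ _ _ fun i _ ↦ ?_
    exact (gaussian_linear_abs_gt_le _ zero_le_one (by simp [Pi.single_apply]) hs0).trans
      (by linarith)
  have hm2 : μ.real (⋃ i, {x | F i * s ^ 2 < |x ⬝ᵥ (A i *ᵥ x) - (A i).trace|}) ≤
      Fintype.card ι * (6 * E) := by
    refine (measureReal_iUnion_fintype_le _).trans ?_
    rw [← nsmul_eq_mul, ← card_univ]
    refine sum_le_card_nsmul _ _ _ fun i _ ↦ ?_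
    exact (gaussian_quadratic_abs_gt_le (hA i) (Real.sqrt_nonneg _) (hF2 i).ge _).trans
      (by linarith)
  have hm3 : μ.real {x | b * s < |∑ i, (A i).trace * x i|} ≤ Fintype.card ι * (2 * E) := by
    refine (gaussian_linear_abs_gt_le _ hb0 hb2 hs0).trans ?_
    nlinarith
  calc _ ≤ _ := measureReal_mono hsub
    _ ≤ Fintype.card ι * (2 * E) + Fintype.card ι * (6 * E) + Fintype.card ι * (2 * E) :=
      (measureReal_union_le _ _).trans
        (add_le_add ((measureReal_union_le _ _).trans (add_le_add hm1 hm2)) hm3)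
    _ = _ := by ring

/-- There exist absolute constants `C, C' > 0` such that for every `n`, every symmetric
3-indexed real array `a` (invariant under all permutations of its indices) with Frobenius
norm `‖a‖_F`, and every `ε > 0`, a standard Gaussian vector `X ∼ N(0, Iₙ)` satisfies
`|∑_{i₁,i₂,i₃} a_{i₁,i₂,i₃} X_{i₁} X_{i₂} X_{i₃}| ≤ 4 ‖a‖_F n^{0.5+ε}` with probability
at least `1 − C·n·exp(−C'·n^{2ε/3})`. -/
theorem coupled_third_order_gaussian_chaos_concentration :
    ∃ C C' : ℝ, 0 < C ∧ 0 < C' ∧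
      ∀ (n : ℕ) (a : Fin n → Fin n → Fin n → ℝ),
      (∀ i j l, a i j l = a j i l) → (∀ i j l, a i j l = a i l j) →
      ∀ ε : ℝ, 0 < ε →
      ENNReal.ofReal (1 - C * n * Real.exp (-C' * (n : ℝ) ^ (2 * ε / 3))) ≤
        (Measure.pi fun _ : Fin n => gaussianReal 0 1)
          {x | |∑ i, ∑ j, ∑ l, a i j l * x i * x j * x l| ≤
            4 * Real.sqrt (∑ i, ∑ j, ∑ l, a i j l ^ 2) * (n : ℝ) ^ ((0.5 : ℝ) + ε)} := by
  refine ⟨10, 1 / 4, by norm_num, by norm_num, fun n a hsymm₁₂ hsymm₂₃ ε hε ↦ ?_⟩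
  rcases Nat.eq_zero_or_pos n with rfl | hn
  · simp
  have : Nonempty (Fin n) := ⟨⟨0, hn⟩⟩
  set s : ℝ := (n : ℝ) ^ (ε / 3) with hs
  have hs1 : 1 ≤ s := Real.one_le_rpow (by exact_mod_cast hn) (by positivity)
  have hs2 : (n : ℝ) ^ (2 * ε / 3) = s ^ 2 := by
    rw [hs, ← Real.rpow_natCast, ← Real.rpow_mul (by positivity)]
    congr 1
    push_cast
    ring
  have hs3 : (n : ℝ) ^ ((0.5 : ℝ) + ε) = √n * s ^ 3 := by
    rw [hs, ← Real.rpow_natCast, ← Real.rpow_mul (by positivity), Real.sqrt_eq_rpow,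
      ← Real.rpow_add (by exact_mod_cast hn)]
    congr 1
    push_cast
    ring
  have h := gaussian_cubic_abs_gt_le (fun i ↦ Matrix.of (a i))
    (fun i ↦ Matrix.IsHermitian.ext fun j l ↦ by simpa using (hsymm₂₃ i j l).symm) hs1
  rw [Fintype.card_fin] at h
  have hcubic (x : Fin n → ℝ) : ∑ i, x i * (x ⬝ᵥ (Matrix.of (a i)).mulVec x) =
      ∑ i, ∑ j, ∑ l, a i j l * x i * x j * x l := by
    simp only [dotProduct, Matrix.mulVec, Matrix.of_apply, mul_sum]
    exact sum_congr rfl fun i _ ↦ sum_congr rfl fun j _ ↦ sum_congr rfl fun l _ ↦ by ring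
  simp_rw [hcubic, Matrix.of_apply] at h
  rw [hs2, hs3]
  set S := {x : Fin n → ℝ | |∑ i, ∑ j, ∑ l, a i j l * x i * x j * x l| ≤
    4 * √(∑ i, ∑ j, ∑ l, a i j l ^ 2) * (√n * s ^ 3)} with hS
  rw [← ofReal_measureReal]
  refine ENNReal.ofReal_le_ofReal ?_
  have hcompl : {x : Fin n → ℝ | 4 * √(∑ i, ∑ j, ∑ l, a i j l ^ 2) * (√n * s ^ 3) <
      |∑ i, ∑ j, ∑ l, a i j l * x i * x j * x l|} = Sᶜ := by
    ext x
    simp [hS]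
  rw [hcompl] at h
  have h1 := measureReal_union_le (μ := Measure.pi fun _ : Fin n ↦ gaussianReal 0 1) S Sᶜ
  rw [Set.union_compl_self, probReal_univ] at h1
  linarith
end
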